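/- Let V be a real vector space equipped with a linear symplectic form ω, a compatible complex structure J, and the associated inner product g(u,v) = ω(u,Jv); let W be a one-dimensional complex vector space with hermitian metric, and let α : V → W be a nonzero real linear map, decomposed as α = α_{1,0} + α_{0,1} into its J-complex-linear and J-complex-antilinear parts. Then: (i) if α_{0,1} = 0, the real codimension-two subspace ker α ⊂ V is a J-complex subspace; (ii) if |α_{0,1}| < |α_{1,0}| (operator norms), then ker α is a symplectic subspace of (V,ω). -/

import Mathlib

/-!
STATEMENT 15. Linear algebra of compatible triples: if `α : V → W` is a nonzero real
linear map from a symplectic vector space with compatible complex structure `J` to a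
hermitian complex line `W`, decomposed into complex linear and antilinear parts
`α = α₁₀ + α₀₁`, then (i) `α₀₁ = 0` implies `ker α` is `J`-complex, and
(ii) `‖α₀₁‖ < ‖α₁₀‖` implies `ker α` is a symplectic subspace.
-/

open scoped RealInnerProductSpace

theorem kernel_complex_and_symplectic
    {V : Type*} [NormedAddCommGroup V] [InnerProductSpace ℝ V]
    {W : Type*} [NormedAddCommGroup W] [InnerProductSpace ℂ W]
    (hW : Module.finrank ℂ W = 1)
    -- the symplectic form and the compatible complex structure
    (ω : V →ₗ[ℝ] V →ₗ[ℝ] ℝ) (J : V →L[ℝ] V)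
    (hskew : ∀ u v, ω u v = - ω v u)
    (hJsq : ∀ v, J (J v) = -v)
    (hJω : ∀ u v, ω (J u) (J v) = ω u v)
    -- the inner product of `V` is the one associated to `(ω, J)`: `g(u,v) = ω(u, Jv)`
    (hg : ∀ u v, ⟪u, v⟫ = ω u (J v))
    -- `α` and its complex linear and antilinear parts
    (α α₁₀ α₀₁ : V →L[ℝ] W)
    (hα : α ≠ 0)
    (hsplit : α = α₁₀ + α₀₁)
    (h10 : ∀ v, α₁₀ (J v) = Complex.I • α₁₀ v)
    (h01 : ∀ v, α₀₁ (J v) = - (Complex.I • α₀₁ v)) :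
    -- (i) if `α₀₁ = 0` then `ker α` is a complex (i.e. `J`-invariant) subspace
    (α₀₁ = 0 → ∀ v, α v = 0 → α (J v) = 0) ∧
    -- (ii) if `‖α₀₁‖ < ‖α₁₀‖` then `ker α` is a symplectic subspace of `(V, ω)`
    (‖α₀₁‖ < ‖α₁₀‖ → ∀ u, α u = 0 → u ≠ 0 → ∃ v, α v = 0 ∧ ω u v ≠ 0) := by
  refine ⟨?_, ?_⟩
  · intro h v hv
    subst h
    rw [hsplit] at hv ⊢
    simp only [ContinuousLinearMap.add_apply, ContinuousLinearMap.zero_apply, add_zero] at hv ⊢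
    rw [h10, hv, smul_zero]
  intro hlt u hu hu0
  by_contra hcon
  push Not at hcon
  refine absurd hlt (not_lt.mpr ?_)
  obtain ⟨e, he0, he⟩ := finrank_eq_one_iff'.mp hW
  -- the functional factors through `α`
  have hfac : ∃ l : W →ₗ[ℝ] ℝ, ∀ v, ω u v = l (α v) := by
    have h1 : (ω u) ∈ LinearMap.range (α : V →ₗ[ℝ] W).dualMap := by
      rw [LinearMap.range_dualMap_eq_dualAnnihilator_ker, Submodule.mem_dualAnnihilator]
      intro w hw
      exact hcon w (by simpa using hw)
    obtain ⟨l, hl⟩ := h1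
    refine ⟨l, fun v => ?_⟩
    rw [← hl]
    rfl
  obtain ⟨l, hl⟩ := hfac
  have hJin : ∀ v w, ⟪J v, J w⟫ = ⟪v, w⟫ := by
    intro v w
    rw [hg, hg, hJω]
  have hJn : ∀ v, ‖J v‖ = ‖v‖ := by
    intro v
    have := hJin v v
    rw [real_inner_self_eq_norm_sq, real_inner_self_eq_norm_sq] at this
    exact (sq_eq_sq₀ (norm_nonneg _) (norm_nonneg _)).mp this
  have hvJ : ∀ v, ⟪v, J v⟫ = 0 := by
    intro v
    have h := hskew v v
    rw [hg, hJsq, map_neg]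
    linarith
  have hp : ∀ v, ⟪J u, v⟫ = l (α v) := by
    intro v
    rw [hg, hJω, hl]
  set p := J u with hpdef
  have hp0 : p ≠ 0 := by
    intro h
    apply hu0
    have := hJn u
    rw [← hpdef, h, norm_zero] at this
    exact norm_eq_zero.mp this.symm
  have hfg : ∀ v, l (α₁₀ v) + l (α₀₁ v) = ⟪p, v⟫ := by
    intro v
    rw [hp, hsplit, ContinuousLinearMap.add_apply, map_add]
  have heq : α₁₀ p = α₀₁ p := by
    rw [hpdef, h10, h01, ← smul_neg]
    congr 1
    rw [hsplit, ContinuousLinearMap.add_apply] at hu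
    exact eq_neg_of_add_eq_zero_left hu
  have hpp : ⟪p, p⟫ ≠ 0 := by
    rw [real_inner_self_eq_norm_sq]
    exact pow_ne_zero _ (norm_ne_zero_iff.mpr hp0)
  have hfp : 2 * l (α₁₀ p) = ⟪p, p⟫ := by
    rw [← hfg p, ← heq]; ring
  -- the reflection
  have hR : ∀ v, ∃ w, ‖w‖ = ‖v‖ ∧ l (α₀₁ w) = l (α₁₀ v) := by
    intro v
    refine ⟨(2 * (⟪p, v⟫ / ⟪p, p⟫)) • p - v, ?_, ?_⟩
    · have : ‖(2 * (⟪p, v⟫ / ⟪p, p⟫)) • p - v‖ ^ 2 = ‖v‖ ^ 2 := by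
        rw [← real_inner_self_eq_norm_sq, ← real_inner_self_eq_norm_sq]
        simp only [inner_sub_left, inner_sub_right, real_inner_smul_left, real_inner_smul_right]
        rw [real_inner_comm p v]
        field_simp
        ring
      exact (sq_eq_sq₀ (norm_nonneg _) (norm_nonneg _)).mp this
    · rw [map_sub, map_smul, map_sub, map_smul, ← heq, smul_eq_mul]
      have h2 : 2 * (⟪p, v⟫ / ⟪p, p⟫) * l (α₁₀ p) = ⟪p, v⟫ := by
        have h7 : l (α₁₀ p) = ⟪p, p⟫ / 2 := by linarith
        rw [h7]
        field_simp
      rw [h2, ← hfg]; ring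
  -- coordinates
  obtain ⟨γ, hγ⟩ : ∃ γ : ℂ, ∀ z : ℂ, l (z • e) = (γ * z).re := by
    refine ⟨⟨l e, - l (Complex.I • e)⟩, fun z => ?_⟩
    have h3 : z • e = z.re • e + z.im • (Complex.I • e) := by
      conv_lhs => rw [← Complex.re_add_im z]
      rw [add_smul, mul_smul]
      rfl
    rw [h3, map_add, map_smul, map_smul, Complex.mul_re, smul_eq_mul, smul_eq_mul]
    ring
  have hγ0 : γ ≠ 0 := by
    intro h
    apply hpp
    obtain ⟨z, hz⟩ := he (α p)
    rw [hp, ← hz, hγ, h]; simp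
  refine ContinuousLinearMap.opNorm_le_bound _ (norm_nonneg _) fun v => ?_
  obtain ⟨z, hz⟩ := he (α₁₀ v)
  obtain ⟨ζ, hζ, hζz⟩ : ∃ ζ : ℂ, ‖ζ‖ = 1 ∧ γ * (ζ * z) = ((‖γ‖ * ‖z‖ : ℝ) : ℂ) := by
    by_cases h : z = 0
    · exact ⟨1, by simp, by simp [h]⟩
    · have hn : ‖γ * z‖ ≠ 0 := norm_ne_zero_iff.mpr (mul_ne_zero hγ0 h)
      refine ⟨(‖γ * z‖ : ℂ) / (γ * z), ?_, ?_⟩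
      · rw [norm_div, Complex.norm_real, norm_norm, div_self hn]
      · rw [← norm_mul]
        field_simp
  have hζ2 : ζ.re ^ 2 + ζ.im ^ 2 = 1 := by
    have := Complex.sq_norm ζ
    rw [hζ, Complex.normSq_apply] at this
    linarith
  set v' := ζ.re • v + ζ.im • J v with hv'
  have hnv' : ‖v'‖ = ‖v‖ := by
    have : ‖v'‖ ^ 2 = ‖v‖ ^ 2 := by
      rw [← real_inner_self_eq_norm_sq, ← real_inner_self_eq_norm_sq, hv']
      simp only [inner_add_left, inner_add_right, real_inner_smul_left, real_inner_smul_right]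
      rw [real_inner_comm v (J v), hvJ, hJin]
      linear_combination ⟪v, v⟫ * hζ2
    exact (sq_eq_sq₀ (norm_nonneg _) (norm_nonneg _)).mp this
  have hαv' : α₁₀ v' = (ζ * z) • e := by
    rw [hv', map_add, map_smul, map_smul, h10, mul_smul, hz]
    conv_rhs => rw [← Complex.re_add_im ζ]
    rw [add_smul, mul_smul]
    rfl
  obtain ⟨w, hw, hlw⟩ := hR v'
  obtain ⟨y, hy⟩ := he (α₀₁ w)
  rw [hαv', hγ, hζz, Complex.ofReal_re, ← hy, hγ] at hlw
  have h5 : ‖γ‖ * ‖z‖ ≤ ‖γ‖ * ‖y‖ := by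
    rw [← hlw, ← norm_mul]
    exact Complex.re_le_norm _
  have h6 : ‖z‖ ≤ ‖y‖ := le_of_mul_le_mul_left h5 (norm_pos_iff.mpr hγ0)
  calc ‖α₁₀ v‖ = ‖z‖ * ‖e‖ := by rw [← hz, norm_smul]
    _ ≤ ‖y‖ * ‖e‖ := by gcongr
    _ = ‖α₀₁ w‖ := by rw [← hy, norm_smul]
    _ ≤ ‖α₀₁‖ * ‖w‖ := α₀₁.le_opNorm w
    _ = ‖α₀₁‖ * ‖v‖ := by rw [hw, hnv']
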